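/- arXiv:math/0112278 — 2 statements merged into one kernel-verified Lean document; each statement's English description precedes it below -/
import Mathlib

section
/- For nonzero complex numbers X_{i-1}, X_i, X_{i+1}, Y_{i-1}, Y_i, Y_{i+1} (with all denominators appearing below nonzero), the identity (Y_{i+1}Y_i^{-1}X_i - X_{i+1})·(Y_iY_{i-1}^{-1}X_{i-1} - X_i)^{-1}·(X_{i+1}X_i^{-1}Y_i - Y_{i+1})^{-1} - (X_iX_{i-1}^{-1}Y_{i-1} - Y_i)^{-1} = Y_i^{-1} holds. -/
/-- The involutivity identity:
(Y_{i+1}Y_i^{-1}X_i - X_{i+1})·(Y_iY_{i-1}^{-1}X_{i-1} - X_i)^{-1}·(X_{i+1}X_i^{-1}Y_i - Y_{i+1})^{-1}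
 - (X_iX_{i-1}^{-1}Y_{i-1} - Y_i)^{-1} = Y_i^{-1}. -/
theorem involutivity_identity
    (Xm X Xp Ym Y Yp : ℂ)
    (hXm : Xm ≠ 0) (hX : X ≠ 0) (hXp : Xp ≠ 0)
    (hYm : Ym ≠ 0) (hY : Y ≠ 0) (hYp : Yp ≠ 0)
    (h1 : Y * Ym⁻¹ * Xm - X ≠ 0)
    (h2 : Xp * X⁻¹ * Y - Yp ≠ 0)
    (h3 : X * Xm⁻¹ * Ym - Y ≠ 0) :
    (Yp * Y⁻¹ * X - Xp) * (Y * Ym⁻¹ * Xm - X)⁻¹ * (Xp * X⁻¹ * Y - Yp)⁻¹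
      - (X * Xm⁻¹ * Ym - Y)⁻¹ = Y⁻¹ := by
  have hP : Yp * Y⁻¹ * X - Xp = -(X * Y⁻¹) * (Xp * X⁻¹ * Y - Yp) := by
    field_simp
    ring
  have hM : X * Xm⁻¹ * Ym - Y = -(Ym * Xm⁻¹) * (Y * Ym⁻¹ * Xm - X) := by
    field_simp
    ring
  rw [hP, hM]
  obtain ⟨A, hA⟩ : ∃ A, A = Y * Ym⁻¹ * Xm - X := ⟨_, rfl⟩
  have hXA : X = Y * Ym⁻¹ * Xm - A := by rw [hA]; ring
  rw [mul_right_comm _ _ (Xp * X⁻¹ * Y - Yp)⁻¹, mul_inv_cancel_right₀ h2]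
  rw [← hA] at h1 ⊢
  rw [hXA]
  field_simp
  ring
end

section
/- For nonzero complex numbers X_{i-1}, X_i, X_{i+1}, Y_{i-1}, Y_i, Y_{i+1} with all relevant subexpressions nonzero, setting A = Y_{i+1}Y_i^{-1}X_i - X_{i+1}, B = Y_iY_{i-1}^{-1}X_{i-1} - X_i, C = X_{i+1}X_i^{-1}Y_i - Y_{i+1}, D = X_iX_{i-1}^{-1}Y_{i-1} - Y_i, one has A·B^{-1}·C^{-1} - D^{-1} = Y_i^{-1}. -/
/-- Involutivity via the universal local formulas: with
A = Y_{i+1}Y_i^{-1}X_i - X_{i+1}, B = Y_iY_{i-1}^{-1}X_{i-1} - X_i,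
C = X_{i+1}X_i^{-1}Y_i - Y_{i+1}, D = X_iX_{i-1}^{-1}Y_{i-1} - Y_i,
one has A·B^{-1}·C^{-1} - D^{-1} = Y_i^{-1}. -/
theorem involutivity_universal
    (Xm X Xp Ym Y Yp A B C D : ℂ)
    (hXm : Xm ≠ 0) (hX : X ≠ 0) (hXp : Xp ≠ 0)
    (hYm : Ym ≠ 0) (hY : Y ≠ 0) (hYp : Yp ≠ 0)
    (hA : A = Yp * Y⁻¹ * X - Xp)
    (hB : B = Y * Ym⁻¹ * Xm - X)
    (hC : C = Xp * X⁻¹ * Y - Yp)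
    (hD : D = X * Xm⁻¹ * Ym - Y)
    (hBne : B ≠ 0) (hCne : C ≠ 0) (hDne : D ≠ 0) :
    A * B⁻¹ * C⁻¹ - D⁻¹ = Y⁻¹ := by
  have hAC : A = -(X / Y) * C := by
    rw [hA, hC]
    field_simp
    ring
  have hDB : D = -(Ym / Xm) * B := by
    rw [hD, hB]
    field_simp
    ring
  have hBYm : Xm * Y - X * Ym = Ym * B := by
    rw [hB]
    field_simp
  have hAinv : A * B⁻¹ * C⁻¹ = -(X / Y) * B⁻¹ := by
    rw [hAC]
    field_simp
  have hDinv : D⁻¹ = -(Xm / Ym) * B⁻¹ := by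
    rw [hDB]
    field_simp
  rw [hAinv, hDinv]
  field_simp
  linear_combination hBYm
end
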